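/- arXiv:1412.3644 — 8 statements merged into one kernel-verified Lean document; each statement's English description precedes it below -/
import Mathlib

section
/- For every data word w and every TPTL formula φ: w ⊨ φ (i.e., (w,0,0̄) ⊨ φ, where 0̄ maps every register variable to the initial data value d_0) if and only if w ⊨rel φ (i.e., (w,0,0̃) ⊨rel φ, where 0̃ maps every register variable to 0). -/
/-- Comparison operators `<, ≤, =, ≥, >`. -/
inductive CmpOp : Type
  | lt | le | eq | ge | gt
  deriving DecidableEq

/-- `CmpOp.eval r a c` means `a ∼ c` for the comparison `∼` denoted by `r`. -/
def CmpOp.eval : CmpOp → ℤ → ℤ → Prop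
  | .lt, a, c => a < c
  | .le, a, c => a ≤ c
  | .eq, a, c => a = c
  | .ge, a, c => c ≤ a
  | .gt, a, c => c < a

/-- TPTL formulas over atomic propositions `α` and register variables `V`. -/
inductive TPTL (α V : Type) : Type
  | tt : TPTL α V
  | atom : α → TPTL α V
  | cmp : V → CmpOp → ℤ → TPTL α V
  | not : TPTL α V → TPTL α V
  | and : TPTL α V → TPTL α V → TPTL α V
  | until_ : TPTL α V → TPTL α V → TPTL α V
  | freeze : V → TPTL α V → TPTL α V

/-- A (finite or infinite) data word: a length in `ℕ∞` together with, for every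
position, a set of atomic propositions and a data value in `ℕ`. -/
structure DataWord (α : Type) where
  len : ℕ∞
  val : ℕ → Set α × ℕ

namespace DataWord
variable {α : Type}
/-- Propositions holding at position `i`. -/
def props (w : DataWord α) (i : ℕ) : Set α := (w.val i).1
/-- Data value at position `i` (as an integer). -/
def data (w : DataWord α) (i : ℕ) : ℤ := ((w.val i).2 : ℤ)
/-- `i` is a position of `w`. -/
def Pos (w : DataWord α) (i : ℕ) : Prop := (i : ℕ∞) < w.len
end DataWord

/-- The TPTL satisfaction relation `(w,i,ν) ⊨ φ`. -/
def TPTL.sat {α V : Type} [DecidableEq V] (w : DataWord α) :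
    TPTL α V → ℕ → (V → ℤ) → Prop
  | .tt, _, _ => True
  | .atom p, i, _ => p ∈ w.props i
  | .cmp x r c, i, ν => r.eval (w.data i - ν x) c
  | .not φ, i, ν => ¬ TPTL.sat w φ i ν
  | .and φ ψ, i, ν => TPTL.sat w φ i ν ∧ TPTL.sat w ψ i ν
  | .until_ φ ψ, i, ν => ∃ j, i < j ∧ w.Pos j ∧ TPTL.sat w ψ j ν ∧
      ∀ t, i < t → t < j → TPTL.sat w φ t ν
  | .freeze x φ, i, ν => TPTL.sat w φ i (Function.update ν x (w.data i))

/-- The relative TPTL satisfaction relation `(w,i,δ) ⊨rel φ`. -/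
def TPTL.satRel {α V : Type} [DecidableEq V] (w : DataWord α) :
    TPTL α V → ℕ → (V → ℤ) → Prop
  | .tt, _, _ => True
  | .atom p, i, _ => p ∈ w.props i
  | .cmp x r c, _, δ => r.eval (δ x) c
  | .not φ, i, δ => ¬ TPTL.satRel w φ i δ
  | .and φ ψ, i, δ => TPTL.satRel w φ i δ ∧ TPTL.satRel w ψ i δ
  | .until_ φ ψ, i, δ => ∃ j, i < j ∧ w.Pos j ∧
      TPTL.satRel w ψ j (fun y => δ y + (w.data j - w.data i)) ∧
      ∀ t, i < t → t < j → TPTL.satRel w φ t (fun y => δ y + (w.data t - w.data i))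
  | .freeze x φ, i, δ => TPTL.satRel w φ i (Function.update δ x 0)

/-- The infinite data word `u₁ (u₂)^ω_{+k}`. -/
def omegaWord {α : Type} (u₁ u₂ : List (Set α × ℕ)) (k : ℕ) : DataWord α :=
  ⟨⊤, fun i =>
    if i < u₁.length then u₁.getD i (∅, 0)
    else
      let j := i - u₁.length
      let p := u₂.getD (j % u₂.length) (∅, 0)
      (p.1, p.2 + (j / u₂.length) * k)⟩

theorem sat_iff_satRel_aux {α V : Type} [DecidableEq V] (w : DataWord α) (φ : TPTL α V) :
    ∀ (i : ℕ) (ν : V → ℤ),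
      TPTL.sat w φ i ν ↔ TPTL.satRel w φ i (fun y => w.data i - ν y) := by
  induction φ with
  | tt => intro i ν; simp only [TPTL.sat, TPTL.satRel]
  | atom p => intro i ν; simp only [TPTL.sat, TPTL.satRel]
  | cmp x r c => intro i ν; simp only [TPTL.sat, TPTL.satRel]
  | not φ ih => intro i ν; simp only [TPTL.sat, TPTL.satRel, ih]
  | and φ ψ ih1 ih2 => intro i ν; simp only [TPTL.sat, TPTL.satRel, ih1, ih2]
  | until_ φ ψ ih1 ih2 =>
    intro i ν
    have h : ∀ j, (fun y => w.data i - ν y + (w.data j - w.data i))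
        = (fun y => w.data j - ν y) := by
      intro j; funext y; ring
    simp only [TPTL.sat, TPTL.satRel, ih1, ih2, h]
  | freeze x φ ih =>
    intro i ν
    have h : (fun y => w.data i - Function.update ν x (w.data i) y)
        = Function.update (fun y => w.data i - ν y) x 0 := by
      funext y
      by_cases hy : y = x
      · subst hy; simp
      · simp [hy]
    simp only [TPTL.sat, TPTL.satRel, ih, h]

/-- `w ⊨ φ` (absolute semantics, initial valuation mapping every variable to the
initial data value) iff `w ⊨rel φ` (relative semantics, initial valuation mapping
every variable to 0). -/
theorem sat_iff_satRel {α V : Type} [DecidableEq V]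
    (w : DataWord α) (h0 : w.Pos 0) (φ : TPTL α V) :
    TPTL.sat w φ 0 (fun _ => w.data 0) ↔ TPTL.satRel w φ 0 (fun _ => 0) := by
  simpa using sat_iff_satRel_aux w φ 0 (fun _ => w.data 0)
end

section
/- Let u_1, u_2 be finite data words with u_2 nonempty, let k ∈ ℕ, let w = u_1(u_2)^ω_{+k}, and let i ≥ |u_1| be a position of w. Then for every TPTL formula φ and every register valuation δ: (w,i,δ) ⊨rel φ if and only if (w,i+|u_2|,δ) ⊨rel φ. -/
theorem omegaWord_val_shift {α : Type} (u₁ u₂ : List (Set α × ℕ)) (hu₂ : u₂ ≠ []) (k i : ℕ)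
    (hi : u₁.length ≤ i) :
    (omegaWord u₁ u₂ k).val (i + u₂.length) =
      (((omegaWord u₁ u₂ k).val i).1, ((omegaWord u₁ u₂ k).val i).2 + k) := by
  have hp : 0 < u₂.length := List.length_pos_iff.mpr hu₂
  have h1 : ¬ (i + u₂.length < u₁.length) := by omega
  have h2 : ¬ (i < u₁.length) := by omega
  have h3 : i + u₂.length - u₁.length = (i - u₁.length) + u₂.length := by omega
  simp only [omegaWord, h1, h2, if_false, h3, Nat.add_mod_right, Nat.add_div_right _ hp]
  congr 1
  rw [Nat.succ_mul, add_assoc]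

theorem omegaWord_props_shift {α : Type} (u₁ u₂ : List (Set α × ℕ)) (hu₂ : u₂ ≠ []) (k i : ℕ)
    (hi : u₁.length ≤ i) :
    (omegaWord u₁ u₂ k).props (i + u₂.length) = (omegaWord u₁ u₂ k).props i := by
  simp only [DataWord.props, omegaWord_val_shift u₁ u₂ hu₂ k i hi]

theorem omegaWord_data_shift {α : Type} (u₁ u₂ : List (Set α × ℕ)) (hu₂ : u₂ ≠ []) (k i : ℕ)
    (hi : u₁.length ≤ i) :
    (omegaWord u₁ u₂ k).data (i + u₂.length) = (omegaWord u₁ u₂ k).data i + k := by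
  simp only [DataWord.data, omegaWord_val_shift u₁ u₂ hu₂ k i hi, Nat.cast_add]

/-- For `w = u₁(u₂)^ω_{+k}` and any position `i ≥ |u₁|`:
`(w,i,δ) ⊨rel φ` iff `(w,i+|u₂|,δ) ⊨rel φ`. -/
theorem satRel_period_shift {α V : Type} [DecidableEq V]
    (u₁ u₂ : List (Set α × ℕ)) (hu₂ : u₂ ≠ []) (k : ℕ)
    (i : ℕ) (hi : u₁.length ≤ i) (φ : TPTL α V) (δ : V → ℤ) :
    TPTL.satRel (omegaWord u₁ u₂ k) φ i δ ↔
      TPTL.satRel (omegaWord u₁ u₂ k) φ (i + u₂.length) δ := by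
  induction φ generalizing i δ with
  | tt => simp only [TPTL.satRel]
  | atom p => simp only [TPTL.satRel, omegaWord_props_shift u₁ u₂ hu₂ k i hi]
  | cmp x r c => simp only [TPTL.satRel]
  | not φ ih => simp only [TPTL.satRel, ih i hi δ]
  | and φ ψ ih1 ih2 => simp only [TPTL.satRel, ih1 i hi δ, ih2 i hi δ]
  | freeze x φ ih => simp only [TPTL.satRel]; exact ih i hi _
  | until_ φ ψ ih1 ih2 =>
    have hd : ∀ j, i < j → (omegaWord u₁ u₂ k).data (j + u₂.length) -
        (omegaWord u₁ u₂ k).data (i + u₂.length) =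
        (omegaWord u₁ u₂ k).data j - (omegaWord u₁ u₂ k).data i := by
      intro j hj
      rw [omegaWord_data_shift u₁ u₂ hu₂ k i hi, omegaWord_data_shift u₁ u₂ hu₂ k j (by omega)]
      ring
    have hpos : ∀ j, (omegaWord u₁ u₂ k).Pos j := fun j => ENat.coe_lt_top j
    simp only [TPTL.satRel]
    constructor
    · rintro ⟨j, hij, -, hψ, hφ⟩
      refine ⟨j + u₂.length, by omega, hpos _, ?_, ?_⟩
      · rw [hd j hij]
        exact (ih2 j (by omega) _).1 hψ
      · intro t ht1 ht2
        obtain ⟨s, rfl⟩ : ∃ s, t = s + u₂.length := ⟨t - u₂.length, by omega⟩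
        rw [hd s (by omega)]
        exact (ih1 s (by omega) _).1 (hφ s (by omega) (by omega))
    · rintro ⟨j, hij, -, hψ, hφ⟩
      obtain ⟨j, rfl⟩ : ∃ s, j = s + u₂.length := ⟨j - u₂.length, by omega⟩
      refine ⟨j, by omega, hpos _, ?_, ?_⟩
      · rw [hd j (by omega)] at hψ
        exact (ih2 j (by omega) _).2 hψ
      · intro t ht1 ht2
        have := hφ (t + u₂.length) (by omega) (by omega)
        rw [hd t ht1] at this
        exact (ih1 t (by omega) _).2 this
end

section
/- Call a TPTL formula closed if every occurrence of a constraint x∼c in it lies within the scope of a freeze quantifier x.(·) binding the same register variable x. Let u_1, u_2 be finite data words with u_2 nonempty, let k ∈ ℕ, and let w = u_1(u_2)^ω_{+k}. If φ is a closed TPTL formula and i ≥ |u_1| is a position of w, then for every register valuation ν: (w,i,ν) ⊨ φ if and only if (w,i+|u_2|,ν) ⊨ φ. -/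
/-- The set of register variables with a free occurrence (in a constraint not in
the scope of a freeze quantifier binding that variable). -/
def TPTL.freeVars {α V : Type} : TPTL α V → Set V
  | .tt => ∅
  | .atom _ => ∅
  | .cmp x _ _ => {x}
  | .not φ => φ.freeVars
  | .and φ ψ => φ.freeVars ∪ ψ.freeVars
  | .until_ φ ψ => φ.freeVars ∪ ψ.freeVars
  | .freeze x φ => φ.freeVars \ {x}

/-- A TPTL formula is closed if every occurrence of a constraint `x ∼ c` lies
within the scope of a freeze quantifier `x.(·)` binding the same variable. -/
def TPTL.Closed {α V : Type} (φ : TPTL α V) : Prop := φ.freeVars = ∅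

theorem omegaWord_shift {α : Type} (u₁ u₂ : List (Set α × ℕ)) (hu₂ : u₂ ≠ []) (k : ℕ)
    (i : ℕ) (hi : u₁.length ≤ i) :
    (omegaWord u₁ u₂ k).val (i + u₂.length) =
      (((omegaWord u₁ u₂ k).val i).1, ((omegaWord u₁ u₂ k).val i).2 + k) := by
  have hpos : 0 < u₂.length := List.length_pos_iff.mpr hu₂
  have h1 : ¬ i < u₁.length := by omega
  have h2 : ¬ i + u₂.length < u₁.length := by omega
  have h3 : i + u₂.length - u₁.length = (i - u₁.length) + u₂.length := by omega
  simp only [omegaWord, h1, h2, if_false, h3, Nat.add_mod_right, Nat.add_div_right _ hpos]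
  refine Prod.ext rfl ?_
  simp only [Nat.succ_eq_add_one]
  ring

theorem sat_shift_aux {α V : Type} [DecidableEq V]
    (u₁ u₂ : List (Set α × ℕ)) (hu₂ : u₂ ≠ []) (k : ℕ) (φ : TPTL α V) :
    ∀ (i : ℕ), u₁.length ≤ i → ∀ (ν ν' : V → ℤ), (∀ x ∈ φ.freeVars, ν' x = ν x + k) →
    (TPTL.sat (omegaWord u₁ u₂ k) φ i ν ↔
      TPTL.sat (omegaWord u₁ u₂ k) φ (i + u₂.length) ν') := by
  have hd : ∀ i, u₁.length ≤ i → (omegaWord u₁ u₂ k).data (i + u₂.length) =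
      (omegaWord u₁ u₂ k).data i + k := by
    intro i hi
    simp [DataWord.data, omegaWord_shift u₁ u₂ hu₂ k i hi]
  induction φ with
  | tt => intros; simp [TPTL.sat]
  | atom p =>
    intro i hi ν ν' h
    simp [TPTL.sat, DataWord.props, omegaWord_shift u₁ u₂ hu₂ k i hi]
  | cmp x r c =>
    intro i hi ν ν' h
    have := h x (by simp [TPTL.freeVars])
    simp only [TPTL.sat, hd i hi, this, add_sub_add_right_eq_sub]
  | not φ ih =>
    intro i hi ν ν' h
    exact not_congr (ih i hi ν ν' h)
  | and φ ψ ih1 ih2 =>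
    intro i hi ν ν' h
    exact and_congr (ih1 i hi ν ν' fun x hx => h x (Or.inl hx))
      (ih2 i hi ν ν' fun x hx => h x (Or.inr hx))
  | until_ φ ψ ih1 ih2 =>
    intro i hi ν ν' h
    have e1 := fun t ht => ih1 t ht ν ν' fun x hx => h x (Or.inl hx)
    have e2 := fun t ht => ih2 t ht ν ν' fun x hx => h x (Or.inr hx)
    have hp : ∀ j, (omegaWord u₁ u₂ k).Pos j := fun j => ENat.coe_lt_top j
    constructor
    · rintro ⟨j, hj, -, h1, h2⟩
      refine ⟨j + u₂.length, by omega, hp _, (e2 j (by omega)).1 h1, fun t ht ht' => ?_⟩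
      have := (e1 (t - u₂.length) (by omega)).1 (h2 _ (by omega) (by omega))
      rwa [Nat.sub_add_cancel (by omega)] at this
    · rintro ⟨j, hj, -, h1, h2⟩
      refine ⟨j - u₂.length, by omega, hp _, (e2 _ (by omega)).2 ?_, fun t ht ht' => ?_⟩
      · rwa [Nat.sub_add_cancel (by omega)]
      · exact (e1 t (by omega)).2 (h2 _ (by omega) (by omega))
  | freeze x φ ih =>
    intro i hi ν ν' h
    refine ih i hi _ _ fun y hy => ?_
    by_cases hxy : y = x
    · subst hxy
      simp [hd i hi]
    · simp only [Function.update_of_ne hxy]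
      exact h y ⟨hy, hxy⟩

/-- Claim 2: for a closed TPTL formula `φ` and `w = u₁(u₂)^ω_{+k}`, satisfaction
at position `i ≥ |u₁|` coincides with satisfaction at position `i + |u₂|`. -/
theorem sat_closed_period_shift {α V : Type} [DecidableEq V]
    (u₁ u₂ : List (Set α × ℕ)) (hu₂ : u₂ ≠ []) (k : ℕ)
    (φ : TPTL α V) (hφ : φ.Closed)
    (i : ℕ) (hi : u₁.length ≤ i) (ν : V → ℤ) :
    TPTL.sat (omegaWord u₁ u₂ k) φ i ν ↔
      TPTL.sat (omegaWord u₁ u₂ k) φ (i + u₂.length) ν := by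
  exact sat_shift_aux u₁ u₂ hu₂ k φ i hi ν ν fun x hx => by
    rw [TPTL.Closed] at hφ
    rw [hφ] at hx
    exact hx.elim
end

section
/- Fix a register variable x and define a translation T from SMTL formulas to TPTL formulas using only the register variable x by: T(true)=true, T(p)=p, T commutes with ¬ and ∧, and T(φ_1 U_I φ_2) = x.(T(φ_1) U (χ_I ∧ T(φ_2))), where for I = I_1 ∪ ⋯ ∪ I_n a finite union of intervals, χ_I is the disjunction over t of the conjunction of the (at most two) constraints x∼c expressing that the difference between the current data value and the value stored in x lies in I_t. Then for every SMTL formula φ, every data word w, every position i of w, and every register valuation ν: (w,i) ⊨ φ (SMTL semantics) if and only if (w,i,ν) ⊨ T(φ) (TPTL semantics). -/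
/-- A syntactic interval of `ℤ`: an optional lower bound and an optional upper
bound (`none` meaning `−∞` resp. `+∞`). -/
abbrev Iv : Type := Option ℤ × Option ℤ

/-- Membership of an integer in a syntactic interval. -/
def Iv.mem (lu : Iv) (d : ℤ) : Prop :=
  (∀ a, lu.1 = some a → a ≤ d) ∧ (∀ b, lu.2 = some b → d ≤ b)

/-- SMTL formulas over atomic propositions `α`: the until modality is annotated
with a finite union of intervals, given as a list of syntactic intervals. -/
inductive SMTL (α : Type) : Type
  | tt : SMTL α
  | atom : α → SMTL α
  | not : SMTL α → SMTL α
  | and : SMTL α → SMTL α → SMTL α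
  | untilI : List Iv → SMTL α → SMTL α → SMTL α

/-- The SMTL satisfaction relation `(w,i) ⊨ φ`. -/
def SMTL.sat {α : Type} (w : DataWord α) : SMTL α → ℕ → Prop
  | .tt, _ => True
  | .atom p, i => p ∈ w.props i
  | .not φ, i => ¬ SMTL.sat w φ i
  | .and φ ψ, i => SMTL.sat w φ i ∧ SMTL.sat w ψ i
  | .untilI I φ ψ, i => ∃ j, i < j ∧ w.Pos j ∧ (∃ lu ∈ I, lu.mem (w.data j - w.data i)) ∧
      SMTL.sat w ψ j ∧ ∀ t, i < t → t < j → SMTL.sat w φ t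

/-- Disjunction of TPTL formulas. -/
def TPTL.or {α V : Type} (φ ψ : TPTL α V) : TPTL α V := .not (.and (.not φ) (.not ψ))

/-- Big disjunction of a list of TPTL formulas. -/
def TPTL.bigOr {α V : Type} (l : List (TPTL α V)) : TPTL α V := l.foldr TPTL.or (.not .tt)

/-- The (at most two) constraints on the single register variable expressing
that the difference between the current data value and the stored value lies in
the syntactic interval `lu`. -/
def ivFormula {α : Type} (lu : Iv) : TPTL α Unit :=
  .and (match lu.1 with | some a => .cmp () .ge a | none => .tt)
       (match lu.2 with | some b => .cmp () .le b | none => .tt)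

/-- The translation `T` from SMTL to TPTL with one register variable:
`T(φ₁ U_I φ₂) = x.(T(φ₁) U (χ_I ∧ T(φ₂)))`. -/
def smtlToTPTL {α : Type} : SMTL α → TPTL α Unit
  | .tt => .tt
  | .atom p => .atom p
  | .not φ => .not (smtlToTPTL φ)
  | .and φ ψ => .and (smtlToTPTL φ) (smtlToTPTL ψ)
  | .untilI I φ ψ => .freeze () (.until_ (smtlToTPTL φ)
      (.and (TPTL.bigOr (I.map ivFormula)) (smtlToTPTL ψ)))

theorem sat_ivFormula {α : Type} (w : DataWord α) (lu : Iv) (j : ℕ) (ν : Unit → ℤ) :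
    TPTL.sat w (ivFormula lu) j ν ↔ lu.mem (w.data j - ν ()) := by
  obtain ⟨a, b⟩ := lu
  cases a <;> cases b <;> simp [ivFormula, TPTL.sat, Iv.mem, CmpOp.eval]

theorem sat_bigOr {α V : Type} [DecidableEq V] (w : DataWord α) (l : List (TPTL α V))
    (j : ℕ) (ν : V → ℤ) :
    TPTL.sat w (TPTL.bigOr l) j ν ↔ ∃ φ ∈ l, TPTL.sat w φ j ν := by
  induction l with
  | nil => simp [TPTL.bigOr, TPTL.sat]
  | cons a l ih =>
    have h : TPTL.sat w (TPTL.bigOr (a :: l)) j ν ↔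
        ¬ (¬ TPTL.sat w a j ν ∧ ¬ TPTL.sat w (TPTL.bigOr l) j ν) := Iff.rfl
    rw [h, ih, List.exists_mem_cons_iff]
    rw [← not_or, not_not]

theorem smtlToTPTL_correct_aux {α : Type} (φ : SMTL α) (w : DataWord α) :
    ∀ (i : ℕ) (ν : Unit → ℤ), SMTL.sat w φ i ↔ TPTL.sat w (smtlToTPTL φ) i ν := by
  induction φ with
  | tt => intro i ν; exact Iff.rfl
  | atom p => intro i ν; exact Iff.rfl
  | not φ ih => intro i ν; exact not_congr (ih i ν)
  | and φ ψ ih1 ih2 => intro i ν; exact and_congr (ih1 i ν) (ih2 i ν)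
  | untilI I φ ψ ih1 ih2 =>
    intro i ν
    simp only [smtlToTPTL, SMTL.sat, TPTL.sat, sat_bigOr, List.mem_map, exists_exists_and_eq_and, sat_ivFormula,
      Function.update_self, and_assoc, ← ih1, ← ih2]

/-- Correctness of the translation: `(w,i) ⊨ φ` (SMTL semantics) iff
`(w,i,ν) ⊨ T(φ)` (TPTL semantics), for every register valuation `ν`. -/
theorem smtlToTPTL_correct {α : Type} (φ : SMTL α) (w : DataWord α)
    (i : ℕ) (hi : w.Pos i) (ν : Unit → ℤ) :
    SMTL.sat w φ i ↔ TPTL.sat w (smtlToTPTL φ) i ν := by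
  exact smtlToTPTL_correct_aux φ w i ν
end

section
/- Let Ψ = Q_1 x_1 ⋯ Q_n x_n φ be a closed quantified Boolean formula (each Q_i ∈ {∀,∃}, φ quantifier-free propositional over x_1,…,x_n). Let w be the finite pure data word 0,1,2,…,2n+1 (all proposition sets empty, data value i at position i, length 2n+2). Using register variables x, x_1, …, x_n, define the TPTL formula Ψ' by recursion on the quantifier prefix: (∀x_i Φ)' = G((x_i=2i−1 ∨ x_i=2i) → x_i.Φ'); (∃x_i Φ)' = F((x_i=2i−1 ∨ x_i=2i) ∧ x_i.Φ'); and for the quantifier-free matrix, φ' = F(x=2n+1 ∧ φ[x_1/(x_1=2n), …, x_i/(x_i=2(n−i)+2), …, x_n/(x_n=2)]), where φ[⋯] replaces every occurrence of the Boolean variable x_i by the constraint x_i=2(n−i)+2, F ψ := true U ψ and G ψ := ¬F¬ψ. Then Ψ evaluates to true if and only if w ⊨ x.x_1.x_2.⋯.x_n.Ψ'. -/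
/-- Quantifier-free propositional Boolean formulas over variables `x_1, …, x_n`
(indexed by `Fin n`). -/
inductive BF (n : ℕ) : Type
  | var : Fin n → BF n
  | not : BF n → BF n
  | and : BF n → BF n → BF n
  | or : BF n → BF n → BF n

/-- Evaluation of a Boolean formula under an assignment. -/
def BF.eval {n : ℕ} (v : Fin n → Bool) : BF n → Bool
  | .var i => v i
  | .not f => !(f.eval v)
  | .and f g => f.eval v && g.eval v
  | .or f g => f.eval v || g.eval v

/-- Truth of the closed QBF `Q_1 x_1 ⋯ Q_n x_n φ` (`Q i = true` means `∀`,
`Q i = false` means `∃`), by recursion on the quantifier prefix starting at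
variable `i` with partial assignment `v`. -/
def qbfEval (n : ℕ) (Q : Fin n → Bool) (φ : BF n) (i : ℕ) (v : Fin n → Bool) : Prop :=
  if h : i < n then
    if Q ⟨i, h⟩ then ∀ b : Bool, qbfEval n Q φ (i + 1) (Function.update v ⟨i, h⟩ b)
    else ∃ b : Bool, qbfEval n Q φ (i + 1) (Function.update v ⟨i, h⟩ b)
  else φ.eval v = true
  termination_by n - i
  decreasing_by all_goals omega

/-- Implication of TPTL formulas. -/
def TPTL.imp {α V : Type} (φ ψ : TPTL α V) : TPTL α V := TPTL.or (.not φ) ψ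

/-- The finally modality `F ψ := true U ψ`. -/
def TPTL.F {α V : Type} (φ : TPTL α V) : TPTL α V := .until_ .tt φ

/-- The globally modality `G ψ := ¬F¬ψ`. -/
def TPTL.G {α V : Type} (φ : TPTL α V) : TPTL α V := .not (TPTL.F (.not φ))

/-- Register variables: `none` is the variable `x`, `some i` is `x_{i+1}`. -/
abbrev QV (n : ℕ) : Type := Option (Fin n)

/-- Translation of the quantifier-free matrix: the Boolean variable `x_i`
(1-based index `i = j+1`) is replaced by the constraint `x_i = 2(n−i)+2`. -/
def BF.toTPTL {n : ℕ} : BF n → TPTL Empty (QV n)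
  | .var j => .cmp (some j) .eq ((2 * (n - (j.1 + 1)) + 2 : ℕ) : ℤ)
  | .not f => .not f.toTPTL
  | .and f g => .and f.toTPTL g.toTPTL
  | .or f g => TPTL.or f.toTPTL g.toTPTL

/-- The formula `Ψ'`, by recursion on the quantifier prefix starting at
variable `i` (0-based; the paper's 1-based variable `x_{i+1}` gets the guard
`x_{i+1} = 2(i+1)−1 ∨ x_{i+1} = 2(i+1)`). -/
def qbfToTPTL (n : ℕ) (Q : Fin n → Bool) (φ : BF n) (i : ℕ) : TPTL Empty (QV n) :=
  if h : i < n then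
    let xi : QV n := some ⟨i, h⟩
    let guard : TPTL Empty (QV n) :=
      TPTL.or (.cmp xi .eq ((2 * i + 1 : ℕ) : ℤ)) (.cmp xi .eq ((2 * i + 2 : ℕ) : ℤ))
    if Q ⟨i, h⟩ then TPTL.G (TPTL.imp guard (.freeze xi (qbfToTPTL n Q φ (i + 1))))
    else TPTL.F (.and guard (.freeze xi (qbfToTPTL n Q φ (i + 1))))
  else TPTL.F (.and (.cmp none .eq ((2 * n + 1 : ℕ) : ℤ)) φ.toTPTL)
  termination_by n - i
  decreasing_by all_goals omega

/-- The freeze prefix `x_1.x_2.⋯.x_n.Ψ'`. -/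
def qbfFreezeChain (n : ℕ) (Q : Fin n → Bool) (φ : BF n) (i : ℕ) : TPTL Empty (QV n) :=
  if h : i < n then .freeze (some ⟨i, h⟩) (qbfFreezeChain n Q φ (i + 1))
  else qbfToTPTL n Q φ 0
  termination_by n - i
  decreasing_by all_goals omega

/-- The finite pure data word `0, 1, 2, …, 2n+1`. -/
def qbfWord (n : ℕ) : DataWord Empty := ⟨((2 * n + 2 : ℕ) : ℕ∞), fun i => (∅, i)⟩

theorem aux_sat_or {α V : Type} [DecidableEq V] (w : DataWord α) (a b : TPTL α V) (i : ℕ)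
    (ν : V → ℤ) : TPTL.sat w (TPTL.or a b) i ν ↔ (TPTL.sat w a i ν ∨ TPTL.sat w b i ν) := by
  simp only [TPTL.or, TPTL.sat]; tauto

theorem aux_sat_imp {α V : Type} [DecidableEq V] (w : DataWord α) (a b : TPTL α V) (i : ℕ)
    (ν : V → ℤ) : TPTL.sat w (TPTL.imp a b) i ν ↔ (TPTL.sat w a i ν → TPTL.sat w b i ν) := by
  simp only [TPTL.imp, aux_sat_or, TPTL.sat]; tauto

theorem aux_sat_F {α V : Type} [DecidableEq V] (w : DataWord α) (a : TPTL α V) (i : ℕ)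
    (ν : V → ℤ) : TPTL.sat w (TPTL.F a) i ν ↔ ∃ j, i < j ∧ w.Pos j ∧ TPTL.sat w a j ν := by
  simp [TPTL.F, TPTL.sat]

theorem aux_sat_G {α V : Type} [DecidableEq V] (w : DataWord α) (a : TPTL α V) (i : ℕ)
    (ν : V → ℤ) : TPTL.sat w (TPTL.G a) i ν ↔ ∀ j, i < j → w.Pos j → TPTL.sat w a j ν := by
  simp only [TPTL.G, TPTL.sat, aux_sat_F]; push Not; rfl

theorem aux_pos (n j : ℕ) : (qbfWord n).Pos j ↔ j < 2 * n + 2 := by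
  unfold DataWord.Pos qbfWord
  exact Nat.cast_lt

theorem aux_data (n j : ℕ) : (qbfWord n).data j = (j : ℤ) := rfl

theorem aux_bf (n : ℕ) (v : Fin n → Bool) (ν : QV n → ℤ)
    (h : ∀ k : Fin n, ν (some k) = if v k then 2 * (k.1 : ℤ) + 1 else 2 * (k.1 : ℤ) + 2) (φ : BF n) :
    TPTL.sat (qbfWord n) φ.toTPTL (2 * n + 1) ν ↔ φ.eval v = true := by
  induction φ with
  | var k =>
    simp only [BF.toTPTL, TPTL.sat, BF.eval, CmpOp.eval, aux_data, h]
    have := k.2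
    cases v k <;> simp <;> omega
  | not f ih => simp [BF.toTPTL, TPTL.sat, BF.eval, ih]
  | and f g ih1 ih2 => simp [BF.toTPTL, TPTL.sat, BF.eval, ih1, ih2]
  | or f g ih1 ih2 => simp [BF.toTPTL, aux_sat_or, BF.eval, ih1, ih2]

theorem aux_main (n : ℕ) (Q : Fin n → Bool) (φ : BF n) (m : ℕ) :
    ∀ (i p : ℕ) (v : Fin n → Bool) (ν : QV n → ℤ), n - i = m → i ≤ n → p ≤ 2 * i → ν none = 0 →
    (∀ k : Fin n, ν (some k) = if k.1 < i then
      (if v k then 2 * (k.1 : ℤ) + 1 else 2 * (k.1 : ℤ) + 2) else 0) →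
    (qbfEval n Q φ i v ↔ TPTL.sat (qbfWord n) (qbfToTPTL n Q φ i) p ν) := by
  induction m with
  | zero =>
    intro i p v ν hm hi hp h0 hk
    have hin : i = n := by omega
    subst hin
    rw [qbfEval, qbfToTPTL]
    simp only [lt_irrefl, dite_false, aux_sat_F, aux_pos]
    have hb := aux_bf i v ν (fun k => by rw [hk, if_pos k.2]) φ
    rw [← hb]
    constructor
    · intro h
      refine ⟨2 * i + 1, by omega, by omega, ?_, h⟩
      simp [TPTL.sat, CmpOp.eval, aux_data, h0]
    · rintro ⟨j, h1, h2, h3, h4⟩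
      simp only [TPTL.sat, CmpOp.eval, aux_data, h0] at h3
      have : j = 2 * i + 1 := by omega
      rwa [this] at h4
  | succ m ih =>
    intro i p v ν hm hi hp h0 hk
    have hin : i < n := by omega
    have hx : ν (some ⟨i, hin⟩) = 0 := by rw [hk]; simp
    have key : ∀ b : Bool, qbfEval n Q φ (i + 1) (Function.update v ⟨i, hin⟩ b) ↔
        TPTL.sat (qbfWord n) (qbfToTPTL n Q φ (i + 1)) (if b then 2 * i + 1 else 2 * i + 2)
          (Function.update ν (some ⟨i, hin⟩) ((qbfWord n).data (if b then 2 * i + 1 else 2 * i + 2))) := by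
      intro b
      apply ih _ _ _ _ (by omega) (by omega)
      · split <;> omega
      · simp [h0]
      · intro k
        by_cases hki : k = ⟨i, hin⟩
        · subst hki
          cases b <;> simp [aux_data]
        · have hne : k.1 ≠ i := fun h => hki (Fin.ext h)
          have : (k.1 < i + 1) = (k.1 < i) := by apply propext; omega
          simp [Function.update_of_ne, hki, hk, this]
    have guard : ∀ j : ℕ, ((TPTL.sat (qbfWord n) (TPTL.or (.cmp (some ⟨i, hin⟩) .eq ((2 * i + 1 : ℕ) : ℤ))
        (.cmp (some ⟨i, hin⟩) .eq ((2 * i + 2 : ℕ) : ℤ))) j ν) ↔ (j = 2 * i + 1 ∨ j = 2 * i + 2)) := by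
      intro j
      simp only [aux_sat_or, TPTL.sat, CmpOp.eval, aux_data, hx]
      omega
    rw [qbfEval, qbfToTPTL]
    simp only [hin, dite_true]
    split
    · simp only [aux_sat_G, aux_sat_imp, guard, aux_pos]
      constructor
      · rintro h j h1 h2 (rfl | rfl)
        · exact (key true).1 (h true)
        · exact (key false).1 (h false)
      · intro h b
        rw [key]
        cases b
        · exact h (2 * i + 2) (by omega) (by omega) (Or.inr rfl)
        · exact h (2 * i + 1) (by omega) (by omega) (Or.inl rfl)
    · simp only [aux_sat_F, TPTL.sat, guard, aux_pos]
      constructor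
      · rintro ⟨b, h⟩
        rw [key] at h
        cases b
        · exact ⟨2 * i + 2, by omega, by omega, Or.inr rfl, h⟩
        · exact ⟨2 * i + 1, by omega, by omega, Or.inl rfl, h⟩
      · rintro ⟨j, h1, h2, rfl | rfl, h⟩
        · exact ⟨true, (key true).2 h⟩
        · exact ⟨false, (key false).2 h⟩

theorem aux_chain (n : ℕ) (Q : Fin n → Bool) (φ : BF n) (m : ℕ) : ∀ i, n - i = m →
    (TPTL.sat (qbfWord n) (qbfFreezeChain n Q φ i) 0 (fun _ => 0) ↔
      TPTL.sat (qbfWord n) (qbfToTPTL n Q φ 0) 0 (fun _ => 0)) := by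
  induction m with
  | zero =>
    intro i hi
    rw [qbfFreezeChain, dif_neg (by omega)]
  | succ m ih =>
    intro i hi
    rw [qbfFreezeChain, dif_pos (by omega)]
    simp only [TPTL.sat, aux_data]
    rw [← ih (i + 1) (by omega)]
    simp

/-- The QBF `Ψ = Q_1 x_1 ⋯ Q_n x_n φ` evaluates to true iff
`w ⊨ x.x_1.x_2.⋯.x_n.Ψ'` over the pure data word `w = 0,1,…,2n+1`. -/
theorem qbf_iff_tptl (n : ℕ) (Q : Fin n → Bool) (φ : BF n) :
    qbfEval n Q φ 0 (fun _ => false) ↔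
      TPTL.sat (qbfWord n) (.freeze none (qbfFreezeChain n Q φ 0)) 0 (fun _ => 0) := by
  rw [aux_main n Q φ n 0 0 (fun _ => false) (fun _ => 0) (by omega) (by omega) (by omega) rfl
    (by simp), ← aux_chain n Q φ n 0 (by omega)]
  simp [TPTL.sat, aux_data]
end

section
/- Let n ≥ 1 and let a_1, a_2, …, a_{2n}, b be positive natural numbers. Let w be the infinite pure strictly monotonic data word with d_i = i for all i ≥ 0 (all proposition sets empty). Using two register variables x and y, define TPTL formulas φ_{2n+1} = (x = b); φ_i = y.G((y=1 ∨ y=a_i) → φ_{i+1}) for odd i with 1 ≤ i ≤ 2n−1; and φ_i = y.F((y=1 ∨ y=a_i) ∧ φ_{i+1}) for even i with 2 ≤ i ≤ 2n, where F ψ := true U ψ and G ψ := ¬F¬ψ. Then w ⊨ x.φ_1 if and only if ∀x_1∈{1,a_1} ∃x_2∈{1,a_2} ⋯ ∀x_{2n−1}∈{1,a_{2n−1}} ∃x_{2n}∈{1,a_{2n}} : Σ_{i=1}^{2n} x_i = b. -/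
/-- The positive quantified subset sum property
`∀x₁∈{1,a₁} ∃x₂∈{1,a₂} ⋯ ∀x_{2n−1}∈{1,a_{2n−1}} ∃x_{2n}∈{1,a_{2n}} : Σ xᵢ = b`,
by recursion on the index `j` (0-based) with running sum `s`. -/
def pqss (n : ℕ) (a : Fin (2 * n) → ℕ) (b : ℕ) (j : ℕ) (s : ℕ) : Prop :=
  if h : j < 2 * n then
    if j % 2 = 0 then ∀ v ∈ ({1, a ⟨j, h⟩} : Set ℕ), pqss n a b (j + 1) (s + v)
    else ∃ v ∈ ({1, a ⟨j, h⟩} : Set ℕ), pqss n a b (j + 1) (s + v)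
  else s = b
  termination_by 2 * n - j
  decreasing_by all_goals omega

/-- The infinite pure strictly monotonic data word with `d_i = i`. -/
def natWord : DataWord Empty := ⟨⊤, fun i => (∅, i)⟩

/-- Register variables: `false` is `x`, `true` is `y`. The formulas
`φ_{2n+1} = (x = b)`, `φ_i = y.G((y=1 ∨ y=a_i) → φ_{i+1})` for odd `i`, and
`φ_i = y.F((y=1 ∨ y=a_i) ∧ φ_{i+1})` for even `i` (0-based index `j = i−1`). -/
def pqssFormula (n : ℕ) (a : Fin (2 * n) → ℕ) (b : ℕ) (j : ℕ) : TPTL Empty Bool :=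
  if h : j < 2 * n then
    let g : TPTL Empty Bool :=
      TPTL.or (.cmp true .eq 1) (.cmp true .eq ((a ⟨j, h⟩ : ℕ) : ℤ))
    if j % 2 = 0 then .freeze true (TPTL.G (TPTL.imp g (pqssFormula n a b (j + 1))))
    else .freeze true (TPTL.F (.and g (pqssFormula n a b (j + 1))))
  else .cmp false .eq ((b : ℕ) : ℤ)
  termination_by 2 * n - j
  decreasing_by all_goals omega

theorem pqss_aux (n : ℕ) (a : Fin (2 * n) → ℕ) (ha : ∀ i, 0 < a i) (b : ℕ) :
    ∀ k j s : ℕ, 2 * n - j = k → ∀ ν : Bool → ℤ, ν false = 0 →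
      (TPTL.sat natWord (pqssFormula n a b j) s ν ↔ pqss n a b j s) := by
  have hd : ∀ i : ℕ, natWord.data i = (i : ℤ) := fun i => rfl
  have hp : ∀ i : ℕ, natWord.Pos i := fun i => ENat.coe_lt_top i
  intro k
  induction k with
  | zero =>
    intro j s hk ν hν
    have h : ¬ j < 2 * n := by omega
    rw [pqssFormula, pqss, dif_neg h, dif_neg h]
    simp only [TPTL.sat, CmpOp.eval, hd, hν]
    omega
  | succ k ih =>
    intro j s hk ν hν
    have h : j < 2 * n := by omega
    have h0 := ha ⟨j, h⟩
    have ih2 : ∀ t : ℕ, TPTL.sat natWord (pqssFormula n a b (j + 1)) t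
        (Function.update ν true (s : ℤ)) ↔ pqss n a b (j + 1) t := fun t =>
      ih (j + 1) t (by omega) _ (by simp [hν])
    rw [pqssFormula, pqss, dif_pos h, dif_pos h]
    by_cases hj : j % 2 = 0
    · simp only [hj, if_true, TPTL.G, TPTL.F, TPTL.imp, TPTL.or, TPTL.sat, CmpOp.eval, hd, hp,
        ih2, Function.update_self]
      constructor
      · intro H v hv
        by_contra hc
        refine H ⟨s + v, ?_, trivial, ?_, fun _ _ _ => trivial⟩
        · rcases hv with rfl | rfl <;> omega
        · intro h2
          apply h2
          refine ⟨fun h3 => h3 fun h4 => ?_, hc⟩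
          rcases hv with rfl | rfl
          · exact h4.1 (by push_cast; ring)
          · exact h4.2 (by push_cast; ring)
      · rintro H ⟨t, hst, -, h2, -⟩
        apply h2
        rintro ⟨h3, h4⟩
        apply h3
        rintro h5
        apply h5
        refine ⟨fun h6 => h4 ?_, fun h6 => h4 ?_⟩
        · have := H 1 (Or.inl rfl)
          rwa [show s + 1 = t by omega] at this
        · have := H (a ⟨j, h⟩) (Or.inr rfl)
          rwa [show s + a ⟨j, h⟩ = t by omega] at this
    · simp only [hj, if_false, TPTL.F, TPTL.or, TPTL.sat, CmpOp.eval, hd, hp,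
        ih2, Function.update_self]
      constructor
      · rintro ⟨t, hst, -, ⟨h2, h3⟩, -⟩
        by_cases h4 : (t : ℤ) - s = 1
        · refine ⟨1, Or.inl rfl, ?_⟩
          rwa [show s + 1 = t by omega]
        · by_cases h5 : (t : ℤ) - s = (a ⟨j, h⟩ : ℕ)
          · refine ⟨a ⟨j, h⟩, Or.inr rfl, ?_⟩
            rwa [show s + a ⟨j, h⟩ = t by omega]
          · exact absurd ⟨h4, h5⟩ h2
      · rintro ⟨v, hv, H⟩
        refine ⟨s + v, ?_, trivial, ⟨fun h4 => ?_, H⟩, fun _ _ _ => trivial⟩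
        · rcases hv with rfl | rfl <;> omega
        · rcases hv with rfl | rfl
          · exact h4.1 (by push_cast; ring)
          · exact h4.2 (by push_cast; ring)

/-- `w ⊨ x.φ₁` over the data word `0,1,2,3,…` iff the positive quantified
subset sum instance `a₁,…,a_{2n},b` is positive. -/
theorem pqss_iff_tptl (n : ℕ) (hn : 1 ≤ n) (a : Fin (2 * n) → ℕ)
    (ha : ∀ i, 0 < a i) (b : ℕ) (hb : 0 < b) :
    TPTL.sat natWord (.freeze false (pqssFormula n a b 0)) 0 (fun _ => 0) ↔
      pqss n a b 0 0 := by
  exact pqss_aux n a ha b _ 0 0 rfl _ (by simp [natWord, DataWord.data])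
end

section
/- Let w = (P_0,d_0)(P_1,d_1)⋯ and w' = (P_0,d'_0)(P_1,d'_1)⋯ be two infinite data words with identical propositional components, and let ψ be a TPTL formula. Suppose that for all positions i ≤ j and every constraint subformula x∼c of ψ: d_j − d_i ∼ c holds if and only if d'_j − d'_i ∼ c holds. Then w ⊨ ψ if and only if w' ⊨ ψ. -/
/-- The set of constraint subformulas `x ∼ c` of a TPTL formula, as triples `(x, ∼, c)`. -/
def TPTL.constraints {α V : Type} : TPTL α V → Set (V × CmpOp × ℤ)
  | .tt => ∅
  | .atom _ => ∅
  | .cmp x r c => {(x, r, c)}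
  | .not φ => φ.constraints
  | .and φ ψ => φ.constraints ∪ ψ.constraints
  | .until_ φ ψ => φ.constraints ∪ ψ.constraints
  | .freeze _ φ => φ.constraints

theorem sat_aux {α V : Type} [DecidableEq V]
    (P : ℕ → Set α) (d d' : ℕ → ℕ) (ψ : TPTL α V) :
    (∀ i j, i ≤ j → ∀ x r c, (x, r, c) ∈ ψ.constraints →
      (r.eval ((d j : ℤ) - (d i : ℤ)) c ↔ r.eval ((d' j : ℤ) - (d' i : ℤ)) c)) →
    ∀ (i : ℕ) (ρ : V → ℕ), (∀ x, ρ x ≤ i) →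
    (TPTL.sat ⟨⊤, fun i => (P i, d i)⟩ ψ i (fun x => (d (ρ x) : ℤ)) ↔
      TPTL.sat ⟨⊤, fun i => (P i, d' i)⟩ ψ i (fun x => (d' (ρ x) : ℤ))) := by
  induction ψ with
  | tt => intro _ i ρ _; exact Iff.rfl
  | atom p => intro _ i ρ _; exact Iff.rfl
  | cmp x r c =>
    intro h i ρ hρ
    exact h (ρ x) i (hρ x) x r c rfl
  | not φ ih =>
    intro h i ρ hρ
    exact not_congr (ih h i ρ hρ)
  | and φ ψ ih1 ih2 =>
    intro h i ρ hρ
    exact and_congr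
      (ih1 (fun i j hij x r c hm => h i j hij x r c (Or.inl hm)) i ρ hρ)
      (ih2 (fun i j hij x r c hm => h i j hij x r c (Or.inr hm)) i ρ hρ)
  | until_ φ ψ ih1 ih2 =>
    intro h i ρ hρ
    have h1 := ih1 (fun i j hij x r c hm => h i j hij x r c (Or.inl hm))
    have h2 := ih2 (fun i j hij x r c hm => h i j hij x r c (Or.inr hm))
    refine exists_congr fun j => and_congr_right fun hj => and_congr Iff.rfl ?_
    refine and_congr (h2 j ρ fun x => (hρ x).trans hj.le) ?_
    exact forall_congr' fun t => forall_congr' fun ht => forall_congr' fun _ =>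
      h1 t ρ fun x => (hρ x).trans ht.le
  | freeze x φ ih =>
    intro h i ρ hρ
    have key : ∀ e : ℕ → ℕ, Function.update (fun y => (e (ρ y) : ℤ)) x (e i : ℤ)
        = fun y => (e (Function.update ρ x i y) : ℤ) := by
      intro e
      funext y
      by_cases hy : y = x
      · subst hy; simp
      · simp [hy]
    have hr : ∀ y, Function.update ρ x i y ≤ i := by
      intro y
      by_cases hy : y = x
      · subst hy; simp
      · simpa [hy] using hρ y
    have := ih h i (Function.update ρ x i) hr
    rw [← key d, ← key d'] at this
    exact this

/-- If two infinite data words have the same propositional components and for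
all positions `i ≤ j` the differences `d_j − d_i` and `d'_j − d'_i` satisfy
exactly the same constraint subformulas of `ψ`, then `w ⊨ ψ` iff `w' ⊨ ψ`. -/
theorem sat_of_equiv_differences {α V : Type} [DecidableEq V]
    (P : ℕ → Set α) (d d' : ℕ → ℕ) (ψ : TPTL α V)
    (h : ∀ i j, i ≤ j → ∀ x r c, (x, r, c) ∈ ψ.constraints →
      (r.eval ((d j : ℤ) - (d i : ℤ)) c ↔ r.eval ((d' j : ℤ) - (d' i : ℤ)) c)) :
    TPTL.sat ⟨⊤, fun i => (P i, d i)⟩ ψ 0 (fun _ => (d 0 : ℤ)) ↔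
      TPTL.sat ⟨⊤, fun i => (P i, d' i)⟩ ψ 0 (fun _ => (d' 0 : ℤ)) := by
  exact sat_aux P d d' ψ h 0 (fun _ => 0) (fun _ => le_rfl)
end

section
/- Let n ≥ 1 and let a_1, a_2, …, a_{2n}, b be positive natural numbers. Over propositions {p,q,r}, let w be the infinite data word w = (r,b) · ((q,0) · Π_{i=1}^{2n} (p,1)(p,a_i)(r,0))^ω_{+1}. Define F_p ψ := p U (p ∧ ψ), G_p ψ := ¬F_p¬ψ, X ψ := false U ψ, F ψ := true U ψ, and, using two register variables x and y, the FreezeLTL formulas φ_{2n+1} = (x=0); φ_i = X^{3(i−1)} G_p y.F(q ∧ y=0 ∧ φ_{i+1}) for odd i with 1 ≤ i ≤ 2n−1; and φ_i = X^{3(i−1)} F_p y.F(q ∧ y=0 ∧ φ_{i+1}) for even i with 2 ≤ i ≤ 2n, where X^m iterates X m times. Then w ⊨ x.y.X φ_1 if and only if ∀x_1∈{1,a_1} ∃x_2∈{1,a_2} ⋯ ∀x_{2n−1}∈{1,a_{2n−1}} ∃x_{2n}∈{1,a_{2n}} : Σ_{i=1}^{2n} x_i = b. -/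
/-- The three atomic propositions `p`, `q`, `r`. -/
inductive PQR : Type
  | p | q | r
  deriving DecidableEq

/-- The next modality `X ψ := false U ψ`. -/
def TPTL.X {α V : Type} (φ : TPTL α V) : TPTL α V := .until_ (.not .tt) φ

/-- The iterated next modality `X^m ψ`. -/
def TPTL.Xpow {α V : Type} : ℕ → TPTL α V → TPTL α V
  | 0, φ => φ
  | m + 1, φ => TPTL.X (TPTL.Xpow m φ)

/-- `F_p ψ := p U (p ∧ ψ)`. -/
def Fp {V : Type} (φ : TPTL PQR V) : TPTL PQR V :=
  .until_ (.atom PQR.p) (.and (.atom PQR.p) φ)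

/-- `G_p ψ := ¬F_p ¬ψ`. -/
def Gp {V : Type} (φ : TPTL PQR V) : TPTL PQR V := .not (Fp (.not φ))

/-- The finite data word `Π_{i=1}^{2n} (p,1)(p,a_i)(r,0)`. -/
def pqssBlock (n : ℕ) (a : Fin (2 * n) → ℕ) : List (Set PQR × ℕ) :=
  (List.ofFn fun i : Fin (2 * n) =>
    [({PQR.p}, 1), ({PQR.p}, a i), ({PQR.r}, 0)]).flatten

/-- The infinite data word `w = (r,b) ((q,0) Π_{i=1}^{2n} (p,1)(p,a_i)(r,0))^ω_{+1}`. -/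
def pqssWord (n : ℕ) (a : Fin (2 * n) → ℕ) (b : ℕ) : DataWord PQR :=
  omegaWord [({PQR.r}, b)] (({PQR.q}, 0) :: pqssBlock n a) 1

/-- Register variables: `false` is `x`, `true` is `y`. The FreezeLTL formulas
`φ_{2n+1} = (x=0)`, `φ_i = X^{3(i−1)} G_p y.F(q ∧ y=0 ∧ φ_{i+1})` for odd `i`,
`φ_i = X^{3(i−1)} F_p y.F(q ∧ y=0 ∧ φ_{i+1})` for even `i`
(0-based index `j = i−1`). -/
def pqssFreezeFormula (n : ℕ) (a : Fin (2 * n) → ℕ) (j : ℕ) : TPTL PQR Bool :=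
  if _h : j < 2 * n then
    let inner : TPTL PQR Bool :=
      .freeze true (TPTL.F (.and (.atom PQR.q)
        (.and (.cmp true .eq 0) (pqssFreezeFormula n a (j + 1)))))
    if j % 2 = 0 then TPTL.Xpow (3 * j) (Gp inner)
    else TPTL.Xpow (3 * j) (Fp inner)
  else .cmp false .eq 0
  termination_by 2 * n - j
  decreasing_by all_goals omega

theorem blk_len {β : Type} (x z : β) : ∀ (N : ℕ) (g : Fin N → β),
    (List.ofFn fun i : Fin N => [x, g i, z]).flatten.length = 3 * N
  | 0, g => by simp
  | N + 1, g => by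
    have := blk_len x z N (fun i => g i.succ)
    rw [List.ofFn_succ, List.flatten_cons, List.length_append, this]
    simp; ring

theorem blk_get {β : Type} (x z d : β) : ∀ (N : ℕ) (g : Fin N → β) (i : ℕ) (h : i < N),
    (List.ofFn fun i : Fin N => [x, g i, z]).flatten.getD (3 * i) d = x ∧
    (List.ofFn fun i : Fin N => [x, g i, z]).flatten.getD (3 * i + 1) d = g ⟨i, h⟩ ∧
    (List.ofFn fun i : Fin N => [x, g i, z]).flatten.getD (3 * i + 2) d = z
  | 0, g, i, h => by omega
  | N + 1, g, 0, h => by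
    rw [List.ofFn_succ, List.flatten_cons]; simp
  | N + 1, g, i + 1, h => by
    have := blk_get x z d N (fun i => g i.succ) i (by omega)
    rw [List.ofFn_succ, List.flatten_cons]
    have e1 : 3 * (i + 1) = 3 * i + 1 + 1 + 1 := by ring
    have e2 : 3 * (i + 1) + 1 = 3 * i + 1 + 1 + 1 + 1 := by ring
    have e3 : 3 * (i + 1) + 2 = 3 * i + 2 + 1 + 1 + 1 := by ring
    rw [e2, e3, e1]
    simp only [List.cons_append, List.nil_append, List.getD_cons_succ]
    exact this

theorem w_val (n : ℕ) (a : Fin (2 * n) → ℕ) (b m t : ℕ) (ht : t < 6 * n + 1) :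
    (pqssWord n a b).val (1 + m * (6 * n + 1) + t) =
      (((({PQR.q}, 0) :: pqssBlock n a).getD t (∅, 0)).1,
       ((({PQR.q}, 0) :: pqssBlock n a).getD t (∅, 0)).2 + m) := by
  have hl : (({PQR.q}, 0) :: pqssBlock n a).length = 6 * n + 1 := by
    rw [List.length_cons, pqssBlock, blk_len]; ring
  have e : 1 + m * (6 * n + 1) + t - 1 = t + m * (6 * n + 1) := by omega
  have h1 : (t + m * (6 * n + 1)) % (6 * n + 1) = t := by
    rw [Nat.add_mul_mod_self_right, Nat.mod_eq_of_lt ht]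
  have h2 : (t + m * (6 * n + 1)) / (6 * n + 1) = m := by
    rw [Nat.add_mul_div_right _ _ (by omega), Nat.div_eq_of_lt ht, Nat.zero_add]
  have h0 : ¬ (1 + m * (6 * n + 1) + t < 1) := by omega
  simp only [pqssWord, omegaWord, hl, List.length_singleton, e, h1, h2, h0, if_false, mul_one]

theorem w_q (n : ℕ) (a : Fin (2 * n) → ℕ) (b m : ℕ) :
    (pqssWord n a b).val (1 + m * (6 * n + 1)) = ({PQR.q}, m) := by
  have := w_val n a b m 0 (by omega)
  simpa using this

theorem w_p1 (n : ℕ) (a : Fin (2 * n) → ℕ) (b m i : ℕ) (h : i < 2 * n) :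
    (pqssWord n a b).val (1 + m * (6 * n + 1) + (3 * i + 1)) = ({PQR.p}, 1 + m) := by
  rw [w_val n a b m _ (by omega), List.getD_cons_succ, pqssBlock, (blk_get _ _ _ _ _ i h).1]

theorem w_p2 (n : ℕ) (a : Fin (2 * n) → ℕ) (b m i : ℕ) (h : i < 2 * n) :
    (pqssWord n a b).val (1 + m * (6 * n + 1) + (3 * i + 2)) = ({PQR.p}, a ⟨i, h⟩ + m) := by
  rw [w_val n a b m _ (by omega), List.getD_cons_succ, pqssBlock, (blk_get _ _ _ _ _ i h).2.1]

theorem w_r (n : ℕ) (a : Fin (2 * n) → ℕ) (b m i : ℕ) (h : i < 2 * n) :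
    (pqssWord n a b).val (1 + m * (6 * n + 1) + (3 * i + 3)) = ({PQR.r}, 0 + m) := by
  rw [w_val n a b m _ (by omega), List.getD_cons_succ, pqssBlock, (blk_get _ _ _ _ _ i h).2.2]

theorem w_pos (n : ℕ) (a : Fin (2 * n) → ℕ) (b i : ℕ) : (pqssWord n a b).Pos i := by
  simp [DataWord.Pos, pqssWord, omegaWord]

/-- q-positions are exactly the block starts -/
theorem w_q_iff (n : ℕ) (a : Fin (2 * n) → ℕ) (b k : ℕ)
    (h : PQR.q ∈ (pqssWord n a b).props k) : ∃ m, k = 1 + m * (6 * n + 1) := by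
  rcases Nat.eq_zero_or_pos k with rfl | hk
  · simp [DataWord.props, pqssWord, omegaWord] at h
  have hd := Nat.div_add_mod (k - 1) (6 * n + 1)
  have hlt := Nat.mod_lt (k - 1) (show 0 < 6 * n + 1 by omega)
  generalize hm : (k - 1) / (6 * n + 1) = m at hd
  generalize ht : (k - 1) % (6 * n + 1) = t at hd hlt
  rw [mul_comm] at hd
  have hk' : k = 1 + m * (6 * n + 1) + t := by omega
  refine ⟨m, ?_⟩
  rcases Nat.eq_zero_or_pos t with rfl | htp
  · simpa using hk'
  exfalso
  have h3 : t = 3 * ((t - 1) / 3) + 1 ∨ t = 3 * ((t - 1) / 3) + 2 ∨ t = 3 * ((t - 1) / 3) + 3 := by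
    omega
  have hi : (t - 1) / 3 < 2 * n := by omega
  generalize (t - 1) / 3 = i at h3 hi
  subst hk'
  rcases h3 with rfl | rfl | rfl
  · rw [DataWord.props, w_p1 n a b m i hi] at h; simp at h
  · rw [DataWord.props, w_p2 n a b m i hi] at h; simp at h
  · rw [DataWord.props, w_r n a b m i hi] at h; simp at h

theorem sat_X (n : ℕ) (a : Fin (2 * n) → ℕ) (b : ℕ) (φ : TPTL PQR Bool) (i : ℕ) (ν : Bool → ℤ) :
    TPTL.sat (pqssWord n a b) (TPTL.X φ) i ν ↔ TPTL.sat (pqssWord n a b) φ (i + 1) ν := by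
  simp only [TPTL.X, TPTL.sat]
  constructor
  · rintro ⟨j, hij, -, hs, hf⟩
    have : j = i + 1 := by
      by_contra hne
      exact hf (i + 1) (by omega) (by omega) trivial
    exact this ▸ hs
  · intro h
    exact ⟨i + 1, by omega, w_pos .., h, fun t h1 h2 => by omega⟩

theorem sat_Xpow (n : ℕ) (a : Fin (2 * n) → ℕ) (b : ℕ) (φ : TPTL PQR Bool) (ν : Bool → ℤ) :
    ∀ (k i : ℕ),
    TPTL.sat (pqssWord n a b) (TPTL.Xpow k φ) i ν ↔ TPTL.sat (pqssWord n a b) φ (i + k) ν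
  | 0, i => Iff.rfl
  | k + 1, i => by
    rw [TPTL.Xpow, sat_X, sat_Xpow n a b φ ν k, show i + 1 + k = i + (k + 1) by ring]

theorem sat_Fp (n : ℕ) (a : Fin (2 * n) → ℕ) (b m j : ℕ) (h : j < 2 * n)
    (φ : TPTL PQR Bool) (ν : Bool → ℤ) :
    TPTL.sat (pqssWord n a b) (Fp φ) (1 + m * (6 * n + 1) + 3 * j) ν ↔
      (TPTL.sat (pqssWord n a b) φ (1 + m * (6 * n + 1) + (3 * j + 1)) ν ∨
       TPTL.sat (pqssWord n a b) φ (1 + m * (6 * n + 1) + (3 * j + 2)) ν) := by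
  have p1 := w_p1 n a b m j h
  have p2 := w_p2 n a b m j h
  have p3 := w_r n a b m j h
  generalize 1 + m * (6 * n + 1) = B at *
  simp only [Fp, TPTL.sat]
  constructor
  · rintro ⟨k, hk, -, ⟨hp, hs⟩, hf⟩
    have hc : k = B + (3 * j + 1) ∨ k = B + (3 * j + 2) ∨ k = B + (3 * j + 3) ∨
      B + (3 * j + 3) < k := by omega
    rcases hc with rfl | rfl | rfl | hc
    · exact Or.inl hs
    · exact Or.inr hs
    · rw [DataWord.props, p3] at hp; simp at hp
    · have := hf (B + (3 * j + 3)) (by omega) hc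
      rw [DataWord.props, p3] at this; simp at this
  · rintro (hs | hs)
    · refine ⟨_, by omega, w_pos .., ⟨?_, hs⟩, fun t h1 h2 => by omega⟩
      rw [DataWord.props, p1]; simp
    · refine ⟨_, by omega, w_pos .., ⟨?_, hs⟩, fun t h1 h2 => ?_⟩
      · rw [DataWord.props, p2]; simp
      · obtain rfl : t = B + (3 * j + 1) := by omega
        rw [DataWord.props, p1]; simp

theorem sat_inner (n : ℕ) (a : Fin (2 * n) → ℕ) (b m t v : ℕ) (ht : t < 6 * n + 1) (hv : 0 < v)
    (hd : ((pqssWord n a b).val (1 + m * (6 * n + 1) + t)).2 = v + m)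
    (φ : TPTL PQR Bool) (ν : Bool → ℤ) :
    TPTL.sat (pqssWord n a b) (.freeze true (TPTL.F (.and (.atom PQR.q)
        (.and (.cmp true .eq 0) φ)))) (1 + m * (6 * n + 1) + t) ν ↔
    TPTL.sat (pqssWord n a b) φ (1 + (m + v) * (6 * n + 1))
      (Function.update ν true ((m + v : ℕ) : ℤ)) := by
  have hd' : (pqssWord n a b).data (1 + m * (6 * n + 1) + t) = ((m + v : ℕ) : ℤ) := by
    rw [DataWord.data, hd, add_comm]
  simp only [TPTL.F, TPTL.sat, hd', CmpOp.eval, Function.update_self]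
  constructor
  · rintro ⟨k, hk, -, ⟨hq, he, hs⟩, -⟩
    obtain ⟨m', rfl⟩ := w_q_iff n a b k hq
    rw [DataWord.data, w_q] at he
    have : m' = m + v := by simp only at he; omega
    exact this ▸ hs
  · intro hs
    refine ⟨_, ?_, w_pos .., ⟨?_, ?_, hs⟩, fun _ _ _ => trivial⟩
    · nlinarith
    · rw [DataWord.props, w_q]; simp
    · rw [DataWord.data, w_q]; simp

theorem main_aux (n : ℕ) (a : Fin (2 * n) → ℕ) (ha : ∀ i, 0 < a i) (b : ℕ) :
    ∀ (d j m : ℕ) (ν : Bool → ℤ), 2 * n - j = d → ν false = b →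
    (TPTL.sat (pqssWord n a b) (pqssFreezeFormula n a j) (1 + m * (6 * n + 1)) ν ↔
      pqss n a b j m) := by
  intro d
  induction d with
  | zero =>
    intro j m ν hd hν
    have h : ¬ j < 2 * n := by omega
    rw [pqssFreezeFormula, pqss, dif_neg h, dif_neg h]
    simp only [TPTL.sat, CmpOp.eval, DataWord.data, w_q, hν]
    omega
  | succ d ih =>
    intro j m ν hd hν
    have h : j < 2 * n := by omega
    have key1 := sat_inner n a b m (3 * j + 1) 1 (by omega) one_pos
      (by rw [w_p1 n a b m j h]) (pqssFreezeFormula n a (j + 1)) ν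
    have key2 := sat_inner n a b m (3 * j + 2) (a ⟨j, h⟩) (by omega) (ha _)
      (by rw [w_p2 n a b m j h]) (pqssFreezeFormula n a (j + 1)) ν
    rw [ih (j + 1) _ _ (by omega) (by simpa using hν)] at key1 key2
    rw [pqssFreezeFormula, pqss, dif_pos h, dif_pos h]
    by_cases hp : j % 2 = 0
    · simp only [if_pos hp]
      rw [sat_Xpow, Gp, TPTL.sat, sat_Fp n a b m j h, TPTL.sat, TPTL.sat, key1, key2]
      simp [not_or]
    · simp only [if_neg hp]
      rw [sat_Xpow, sat_Fp n a b m j h, key1, key2]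
      simp

/-- `w ⊨ x.y.X φ₁` iff the positive quantified subset sum instance
`a₁,…,a_{2n},b` is positive. (The initial valuation `0̄` maps every register
variable to the initial data value `b`.) -/
theorem pqss_iff_freezeLTL (n : ℕ) (hn : 1 ≤ n) (a : Fin (2 * n) → ℕ)
    (ha : ∀ i, 0 < a i) (b : ℕ) (hb : 0 < b) :
    TPTL.sat (pqssWord n a b)
        (.freeze false (.freeze true (TPTL.X (pqssFreezeFormula n a 0))))
        0 (fun _ => (b : ℤ)) ↔
      pqss n a b 0 0 := by
  rw [TPTL.sat, TPTL.sat, sat_X]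
  have := main_aux n a ha b _ 0 0 (Function.update (Function.update (fun _ => (b : ℤ)) false
    ((pqssWord n a b).data 0)) true ((pqssWord n a b).data 0)) rfl
    (by simp [DataWord.data, pqssWord, omegaWord])
  simpa only [zero_mul, add_zero, zero_add] using this
end
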